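/- For all α, β ∈ ℝ with α ≠ β, the probability measures P^T_{X^{(α)},T} and P^T_{X^{(β)},T} induced on (C[0,T), ℬ(C[0,T))) by the processes (X^{(α)}_t)_{t∈[0,T)} and (X^{(β)}_t)_{t∈[0,T)} are mutually singular: there exist disjoint Borel sets S_α, S_β ⊆ C[0,T) with P^T_{X^{(α)},T}(S_α) = 1 and P^T_{X^{(β)},T}(S_β) = 1. -/

import Mathlib

open MeasureTheory ProbabilityTheory Filter Set Topology
open scoped ENNReal NNReal

noncomputable section

variable {Ω : Type*} [MeasurableSpace Ω]

/-- `B` is a standard 1-dimensional Wiener process on the probability space `(Ω, 𝒜, P)`: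
it starts at `0`, has a.s. continuous paths, and its increments are independent of the past
and Gaussian with the correct variance. -/
structure IsStandardWiener (P : Measure Ω) (B : ℝ → Ω → ℝ) : Prop where
  meas : ∀ t : ℝ, Measurable (B t)
  init : ∀ᵐ ω ∂P, B 0 ω = 0
  cont : ∀ᵐ ω ∂P, Continuous fun t => B t ω
  incr_indep : ∀ s t : ℝ, 0 ≤ s → s ≤ t →
    IndepFun (fun ω => B t ω - B s ω) (fun ω (u : Set.Icc (0:ℝ) s) => B u.1 ω) P
  incr_law : ∀ s t : ℝ, 0 ≤ s → s ≤ t →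
    Measure.map (fun ω => B t ω - B s ω) P = gaussianReal 0 (Real.toNNReal (t - s))

/-- The `α`-Wiener bridge `X^{(α)}_t = ∫₀ᵗ ((T−t)/(T−s))^α dB_s`, `t ∈ [0,T)`, realized
pathwise through the integration-by-parts representation of the Wiener integral:
`X^{(α)}_t = B_t − α (T−t)^α ∫₀ᵗ (T−s)^{−α−1} B_s ds`. -/
def alphaWienerBridge (T α : ℝ) (B : ℝ → Ω → ℝ) (t : ℝ) (ω : Ω) : ℝ :=
  B t ω - α * (T - t) ^ α * ∫ s in Set.Ioc (0:ℝ) t, (T - s) ^ (-α - 1) * B s ω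

open scoped Classical

/-- The time change `Ψ(u) = (2T/π) arctan u`, mapping `[0,∞)` onto `[0,T)`. -/
def psiMap (T u : ℝ) : ℝ := 2 * T / Real.pi * Real.arctan u

/-- The metric `ρ(x,y) = Σ_{n=1}^∞ 2^{−n} sup_{u∈[0,n]} (|x(Ψ(u)) − y(Ψ(u))| ∧ 1)`
on `C[0,T)`. -/
def rhoMetric (T : ℝ) (x y : ℝ → ℝ) : ℝ :=
  ∑' n : ℕ, (1 / 2 : ℝ) ^ (n + 1) *
    sSup ((fun u => min |x (psiMap T u) - y (psiMap T u)| 1) '' Set.Icc (0:ℝ) (n + 1))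

/-- The space `C[0,T)` of continuous real-valued functions on `[0,T)`. -/
def ContPathIco (T : ℝ) : Type := {x : ℝ → ℝ // ContinuousOn x (Set.Ico 0 T)}

/-- The Borel σ-algebra of the separable metric space `(C[0,T), ρ)`, generated by the
open `ρ`-balls. -/
def borelRho (T : ℝ) : MeasurableSpace (ContPathIco T) :=
  MeasurableSpace.generateFrom
    {S : Set (ContPathIco T) | ∃ (x : ContPathIco T) (r : ℝ),
      S = {y : ContPathIco T | rhoMetric T x.1 y.1 < r}}

/-- The path map `ω ↦ (X^{(α)}_t(ω))_{t∈[0,T)} ∈ C[0,T)` (with an irrelevant default on the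
null set where the path fails to be continuous). -/
def bridgePath (T α : ℝ) (B : ℝ → Ω → ℝ) (ω : Ω) : ContPathIco T :=
  if h : ContinuousOn (fun t => alphaWienerBridge T α B t ω) (Set.Ico 0 T)
  then ⟨fun t => alphaWienerBridge T α B t ω, h⟩
  else ⟨fun _ => 0, continuousOn_const⟩


section Evaluation

variable {T : ℝ}

lemma psiMap_mem_Ico (hT : 0 < T) {u : ℝ} (hu : 0 ≤ u) : psiMap T u ∈ Set.Ico 0 T := by
  have hpi := Real.pi_pos
  have h1 := Real.arctan_nonneg.2 hu
  have h2 := Real.arctan_lt_pi_div_two u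
  refine ⟨by unfold psiMap; positivity, ?_⟩
  unfold psiMap
  rw [div_mul_eq_mul_div, div_lt_iff₀ hpi]
  nlinarith

lemma exists_psiMap_eq (hT : 0 < T) {t : ℝ} (ht : t ∈ Set.Ico 0 T) :
    ∃ u, 0 ≤ u ∧ psiMap T u = t := by
  have hpi := Real.pi_pos
  have h0 : 0 ≤ Real.pi * t / (2 * T) := by have := ht.1; positivity
  have h1 : Real.pi * t / (2 * T) < Real.pi / 2 := by
    rw [div_lt_div_iff₀ (by positivity) (by positivity)]
    nlinarith [ht.2, mul_lt_mul_of_pos_left ht.2 hpi]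
  refine ⟨Real.tan (Real.pi * t / (2 * T)), Real.tan_nonneg_of_nonneg_of_le_pi_div_two h0 h1.le, ?_⟩
  unfold psiMap
  rw [Real.arctan_tan (by linarith) h1]
  field_simp

lemma continuous_psiMap : Continuous (psiMap T) :=
  continuous_const.mul Real.continuous_arctan

lemma rhoMetric_sSup_bounds (x y : ℝ → ℝ) (n : ℕ) :
    0 ≤ sSup ((fun u => min |x (psiMap T u) - y (psiMap T u)| 1) '' Set.Icc (0:ℝ) (n + 1)) ∧
    sSup ((fun u => min |x (psiMap T u) - y (psiMap T u)| 1) '' Set.Icc (0:ℝ) (n + 1)) ≤ 1 := by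
  refine ⟨Real.sSup_nonneg ?_, Real.sSup_le ?_ zero_le_one⟩
  · rintro _ ⟨u, _, rfl⟩
    exact le_min (abs_nonneg _) zero_le_one
  · rintro _ ⟨u, _, rfl⟩
    exact min_le_right _ _

lemma summable_rhoMetric (x y : ℝ → ℝ) :
    Summable fun n : ℕ => (1 / 2 : ℝ) ^ (n + 1) *
      sSup ((fun u => min |x (psiMap T u) - y (psiMap T u)| 1) '' Set.Icc (0:ℝ) (n + 1)) := by
  refine Summable.of_nonneg_of_le
    (fun n => mul_nonneg (by positivity) (rhoMetric_sSup_bounds x y n).1)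
    (fun n => mul_le_of_le_one_right (by positivity) (rhoMetric_sSup_bounds x y n).2) ?_
  exact (summable_nat_add_iff 1).2 summable_geometric_two

/-- Closeness in `rhoMetric` forces closeness at a fixed time. -/
lemma abs_sub_lt_of_rhoMetric_lt {u : ℝ} (hu : 0 ≤ u) {n : ℕ} (hn : u ≤ n + 1)
    {x y : ℝ → ℝ} {r : ℝ} (hr : r ≤ 1) (h : rhoMetric T x y < (1 / 2 : ℝ) ^ (n + 1) * r) :
    |x (psiMap T u) - y (psiMap T u)| < r := by
  have h1 := (summable_rhoMetric (T := T) x y).le_tsum n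
    (fun m _ => mul_nonneg (by positivity) (rhoMetric_sSup_bounds x y m).1)
  have h2 := lt_of_mul_lt_mul_left (h1.trans_lt h) (by positivity)
  have h3 : min |x (psiMap T u) - y (psiMap T u)| 1 ≤
      sSup ((fun u => min |x (psiMap T u) - y (psiMap T u)| 1) '' Set.Icc (0:ℝ) (n + 1)) := by
    refine le_csSup ⟨1, ?_⟩ ⟨u, ⟨hu, hn⟩, rfl⟩
    rintro _ ⟨v, _, rfl⟩
    exact min_le_right _ _
  have h4 := h3.trans_lt h2
  rcases min_lt_iff.1 h4 with h5 | h5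
  · exact h5
  · exact absurd h5 (not_lt.2 hr)

/-- The extension by zero of a continuous function on `[0,T)`. -/
def extendPath (z : C(Set.Ico (0:ℝ) T, ℝ)) : ContPathIco T :=
  ⟨fun t => if h : t ∈ Set.Ico 0 T then z ⟨t, h⟩ else 0, by
    rw [continuousOn_iff_continuous_domRestrict]
    refine z.continuous.congr fun t => ?_
    simp only [Set.domRestrict_apply, dif_pos t.2]⟩

/-- The restriction to `[0,T)` of an element of `C[0,T)`. -/
def restrictPath (y : ContPathIco T) : C(Set.Ico (0:ℝ) T, ℝ) :=
  ⟨(Set.Ico 0 T).domRestrict y.1, y.2.domRestrict⟩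

lemma tendsto_rhoMetric_extendPath (hT : 0 < T) (y : ContPathIco T) :
    Tendsto (fun z => rhoMetric T (extendPath z).1 y.1) (𝓝 (restrictPath y)) (𝓝 0) := by
  have hgeo : Summable fun n : ℕ => (1 / 2 : ℝ) ^ (n + 1) :=
    (summable_nat_add_iff 1).2 summable_geometric_two
  suffices h : Tendsto (fun z => rhoMetric T (extendPath z).1 y.1) (𝓝 (restrictPath y))
      (𝓝 (∑' _ : ℕ, (0 : ℝ))) by simpa using h
  unfold rhoMetric
  refine tendsto_tsum_of_dominated_convergence hgeo (fun n => ?_)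
    (Eventually.of_forall fun z n => ?_)
  · suffices h : Tendsto (fun z => sSup ((fun u => min |(extendPath z).1 (psiMap T u) -
        y.1 (psiMap T u)| 1) '' Set.Icc (0:ℝ) (n + 1))) (𝓝 (restrictPath y)) (𝓝 0) by
      simpa using h.const_mul ((1 / 2 : ℝ) ^ (n + 1))
    set ψ : Set.Icc (0:ℝ) (n + 1) → Set.Ico (0:ℝ) T :=
      fun u => ⟨psiMap T u, psiMap_mem_Ico hT u.2.1⟩ with hψ
    have hψc : Continuous ψ := (continuous_psiMap.comp continuous_subtype_val).subtype_mk _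
    have hK : IsCompact (Set.range ψ) := isCompact_range hψc
    have hu := ContinuousMap.tendsto_iff_forall_isCompact_tendstoUniformlyOn.1
      (tendsto_id (x := 𝓝 (restrictPath y))) _ hK
    rw [Metric.tendsto_nhds]
    intro ε hε
    filter_upwards [Metric.tendstoUniformlyOn_iff.1 hu (ε / 2) (by positivity)] with z hz
    rw [Real.dist_eq, sub_zero, abs_of_nonneg (rhoMetric_sSup_bounds _ _ n).1]
    refine lt_of_le_of_lt (Real.sSup_le ?_ (by positivity)) (half_lt_self hε)
    rintro _ ⟨u, hu, rfl⟩
    refine (min_le_left _ _).trans ?_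
    have := hz (ψ ⟨u, hu⟩) ⟨_, rfl⟩
    rw [Real.dist_eq, abs_sub_comm] at this
    have hm := psiMap_mem_Ico hT hu.1
    simp only [extendPath, hm, dif_pos]
    exact this.le
  · rw [Real.norm_eq_abs, abs_of_nonneg (mul_nonneg (by positivity) (rhoMetric_sSup_bounds _ _ n).1)]
    exact mul_le_of_le_one_right (by positivity) (rhoMetric_sSup_bounds _ _ n).2

/-- Evaluation at a time in `[0,T)` is Borel measurable. -/
lemma measurable_eval_borelRho (hT : 0 < T) {t : ℝ} (ht : t ∈ Set.Ico 0 T) :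
    Measurable[borelRho T] fun y : ContPathIco T => y.1 t := by
  obtain ⟨u, hu, rfl⟩ := exists_psiMap_eq hT ht
  obtain ⟨n, hn⟩ := exists_nat_ge u
  have hn' : u ≤ n + 1 := by linarith
  let _ := borelRho T
  refine measurable_of_Iio fun c => ?_
  have : LocallyCompactSpace (Set.Ico (0:ℝ) T) := isLocallyClosed_Ico.locallyCompactSpace
  obtain ⟨D, hDc, hD⟩ := TopologicalSpace.exists_countable_dense C(Set.Ico (0:ℝ) T, ℝ)
  set S : Set (C(Set.Ico (0:ℝ) T, ℝ) × ℚ) :=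
    {d | d.1 ∈ D ∧ 0 < d.2 ∧ d.2 ≤ 1 ∧ (extendPath d.1).1 (psiMap T u) + d.2 < c} with hS
  have hSc : S.Countable :=
    Set.Countable.mono (s₂ := D ×ˢ Set.univ) (fun d hd => ⟨hd.1, trivial⟩)
      (hDc.prod (Set.to_countable Set.univ))
  have key : (fun y : ContPathIco T => y.1 (psiMap T u)) ⁻¹' Set.Iio c = ⋃ d ∈ S,
      {y : ContPathIco T | rhoMetric T (extendPath d.1).1 y.1 < (1 / 2 : ℝ) ^ (n + 1) * d.2} := by
    ext y
    simp only [Set.mem_preimage, Set.mem_Iio, Set.mem_iUnion, Set.mem_ofPred_eq, exists_prop]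
    constructor
    · intro hy
      obtain ⟨q, hq0, hq⟩ := exists_rat_btwn
        (show (0:ℝ) < min 1 ((c - y.1 (psiMap T u)) / 2) by
          refine lt_min one_pos ?_
          linarith)
      have hq0' : 0 < q := by exact_mod_cast hq0
      have hq1 : (q : ℝ) < 1 := hq.trans_le (min_le_left _ _)
      have hq2 := hq.trans_le (min_le_right _ _)
      have hev := (tendsto_rhoMetric_extendPath hT y).eventually_lt_const
        (show (0:ℝ) < (1 / 2 : ℝ) ^ (n + 1) * q by positivity)
      obtain ⟨z, hzD, hz⟩ := (mem_closure_iff_nhds.1 (hD (restrictPath y)) _ hev)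
      have hlt := abs_sub_lt_of_rhoMetric_lt hu hn' hq1.le hzD
      refine ⟨(z, q), ⟨hz, hq0', by exact_mod_cast hq1.le, ?_⟩, hzD⟩
      have := (abs_lt.1 hlt).2
      simp only
      linarith
    · rintro ⟨⟨z, q⟩, ⟨_, _, hq1, hzc⟩, hlt⟩
      have := (abs_lt.1 (abs_sub_lt_of_rhoMetric_lt hu hn' (by exact_mod_cast hq1) hlt)).1
      simp only at this hzc
      linarith
  rw [key]
  refine MeasurableSet.biUnion hSc fun d _ => ?_
  exact MeasurableSpace.measurableSet_generateFrom ⟨extendPath d.1, _, rfl⟩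

end Evaluation

/-- A bounded sequence in a Hilbert space whose inner products with each of its own members tend
to zero converges weakly to zero. -/
lemma tendsto_inner_zero_of_self {H : Type*} [NormedAddCommGroup H] [InnerProductSpace ℝ H]
    [CompleteSpace H] (u : ℕ → H) (C : ℝ) (hC : ∀ k, ‖u k‖ ≤ C)
    (h : ∀ j, Tendsto (fun k => inner ℝ (u k) (u j)) atTop (𝓝 0)) (g : H) :
    Tendsto (fun k => inner ℝ (u k) g) atTop (𝓝 0) := by
  set K : Submodule ℝ H := (Submodule.span ℝ (Set.range u)).topologicalClosure with hK
  have hsub : ∀ x ∈ Submodule.span ℝ (Set.range u),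
      Tendsto (fun k => inner ℝ (u k) x) atTop (𝓝 0) := by
    intro x hx
    induction hx using Submodule.span_induction with
    | mem x hx => obtain ⟨j, rfl⟩ := hx; exact h j
    | zero => simp
    | add x y _ _ hx hy => simpa [inner_add_right] using hx.add hy
    | smul a x _ hx => simpa [inner_smul_right] using hx.const_mul a
  have hC0 : 0 ≤ C := (norm_nonneg _).trans (hC 0)
  have hclos : ∀ x ∈ K, Tendsto (fun k => inner ℝ (u k) x) atTop (𝓝 0) := by
    intro x hx
    rw [Metric.tendsto_atTop]
    intro ε hε
    have hx' : x ∈ closure (Submodule.span ℝ (Set.range u) : Set H) := hx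
    obtain ⟨y, hy, hxy⟩ := Metric.mem_closure_iff.1 hx' (ε / (2 * (C + 1))) (by positivity)
    obtain ⟨N, hN⟩ := Metric.tendsto_atTop.1 (hsub y hy) (ε / 2) (by positivity)
    refine ⟨N, fun k hk => ?_⟩
    have h1 := hN k hk
    rw [Real.dist_eq, sub_zero] at h1 ⊢
    have h2 : inner ℝ (u k) x = inner ℝ (u k) y + inner ℝ (u k) (x - y) := by
      rw [inner_sub_right]; ring
    have h3 : |inner ℝ (u k) (x - y)| ≤ C * (ε / (2 * (C + 1))) := by
      refine (abs_real_inner_le_norm _ _).trans ?_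
      rw [dist_eq_norm] at hxy
      exact mul_le_mul (hC k) hxy.le (norm_nonneg _) hC0
    have h4 : C * (ε / (2 * (C + 1))) ≤ ε / 2 := by
      rw [mul_div_assoc', div_le_div_iff₀ (by positivity) (by positivity)]
      nlinarith
    rw [h2]
    exact (abs_add_le _ _).trans_lt (by linarith)
  have hcomp : CompleteSpace K := (Submodule.isClosed_topologicalClosure _).completeSpace_coe
  have hmem : ∀ k, u k ∈ K := fun k =>
    Submodule.le_topologicalClosure _ (Submodule.subset_span ⟨k, rfl⟩)
  have key := hclos (K.starProjection g) (Submodule.starProjection_apply_mem K g)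
  refine key.congr fun k => ?_
  have h0 : inner ℝ (u k) (g - K.starProjection g) = 0 :=
    Submodule.inner_right_of_mem_orthogonal (hmem k)
      (Submodule.sub_starProjection_mem_orthogonal g)
  rw [inner_sub_right] at h0
  linarith

section Mixing

variable {E : Type*} [MeasurableSpace E]

/-- `c` is mixing with limit `p` under `μ`: its terms are asymptotically uncorrelated with each
fixed term, with means tending to `p`. -/
structure IsMixingSeq (μ : Measure E) (c : ℕ → E → ℝ) (p : ℝ) : Prop where
  mean : Tendsto (fun k => ∫ x, c k x ∂μ) atTop (𝓝 p)
  corr : ∀ j, Tendsto (fun k => ∫ x, c k x * c j x ∂μ) atTop (𝓝 (p * ∫ x, c j x ∂μ))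

lemma IsMixingSeq.tendsto_integral_mul {μ : Measure E} [IsProbabilityMeasure μ]
    {c : ℕ → E → ℝ} {p : ℝ} (h : IsMixingSeq μ c p) (hc : ∀ k, Measurable (c k))
    (hb : ∀ k x, |c k x| ≤ 1) {g : E → ℝ} (hg : Measurable g) {M : ℝ}
    (hgM : ∀ᵐ x ∂μ, |g x| ≤ M) :
    Tendsto (fun k => ∫ x, c k x * g x ∂μ) atTop (𝓝 (p * ∫ x, g x ∂μ)) := by
  have hgL : MemLp g 2 μ := MemLp.of_bound hg.aestronglyMeasurable M (by simpa using hgM)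
  have hbd : ∀ k, ∀ᵐ x ∂μ, ‖c k x - p‖ ≤ 1 + |p| := fun k => ae_of_all _ fun x =>
    (norm_sub_le _ _).trans (by simpa using hb k x)
  have hcL : ∀ k, MemLp (fun x => c k x - p) 2 μ := fun k =>
    MemLp.of_bound ((hc k).sub_const p).aestronglyMeasurable _ (hbd k)
  have hci : ∀ k, Integrable (c k) μ := fun k =>
    Integrable.of_bound (hc k).aestronglyMeasurable 1 (ae_of_all _ (hb k))
  have hcci : ∀ k j, Integrable (fun x => c k x * c j x) μ := fun k j =>
    Integrable.of_bound ((hc k).mul (hc j)).aestronglyMeasurable 1 (ae_of_all _ fun x => by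
      rw [Real.norm_eq_abs, abs_mul]
      exact mul_le_one₀ (hb k x) (abs_nonneg _) (hb j x))
  have hgi : Integrable g μ := Integrable.of_bound hg.aestronglyMeasurable M (by simpa using hgM)
  have hcgi : ∀ k, Integrable (fun x => c k x * g x) μ := fun k =>
    hgi.bdd_mul (hc k).aestronglyMeasurable (c := 1) (ae_of_all _ (hb k))
  have hinner : ∀ k (f : E → ℝ) (hf : MemLp f 2 μ),
      inner ℝ ((hcL k).toLp) (hf.toLp) = ∫ x, (c k x - p) * f x ∂μ := by
    intro k f hf
    rw [L2.inner_def]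
    refine integral_congr_ae ?_
    filter_upwards [(hcL k).coeFn_toLp, hf.coeFn_toLp] with x h1 h2
    rw [h1, h2]
    simp [mul_comm]
  have hweak := tendsto_inner_zero_of_self (fun k => (hcL k).toLp) (1 + |p|) ?_ ?_ hgL.toLp
  · have h2 := hweak.add_const (p * ∫ x, g x ∂μ)
    rw [zero_add] at h2
    refine h2.congr fun k => ?_
    rw [hinner]
    have : ∀ x, (c k x - p) * g x = c k x * g x - p * g x := fun x => by ring
    simp_rw [this]
    rw [integral_sub (hcgi k) (hgi.const_mul p), integral_const_mul]
    ring
  · intro k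
    rw [Lp.norm_toLp]
    refine ENNReal.toReal_le_of_le_ofReal (by positivity) ?_
    refine (eLpNorm_le_of_ae_bound (hbd k)).trans ?_
    simp
  · intro j
    have e : ∀ k, inner ℝ ((hcL k).toLp) ((hcL j).toLp)
        = ∫ x, c k x * c j x ∂μ - p * ∫ x, c k x ∂μ - p * ∫ x, c j x ∂μ + p * p := by
      intro k
      rw [hinner]
      have : ∀ x, (c k x - p) * (c j x - p) = c k x * c j x - p * c k x - p * c j x + p * p :=
        fun x => by ring
      simp_rw [this]
      have i1 : Integrable (fun x => c k x * c j x - p * c k x) μ :=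
        (hcci k j).sub ((hci k).const_mul p)
      have i2 : Integrable (fun x => c k x * c j x - p * c k x - p * c j x) μ :=
        i1.sub ((hci j).const_mul p)
      rw [integral_add i2 (integrable_const _), integral_sub i1 ((hci j).const_mul p),
        integral_sub (hcci k j) ((hci k).const_mul p), integral_const_mul, integral_const_mul]
      simp
    simp_rw [e]
    have := (((h.corr j).sub (h.mean.const_mul p)).sub_const (p * ∫ x, c j x ∂μ)).add_const (p * p)
    convert this using 2
    ring

/-- Two probability measures under which the same bounded sequence is mixing with different limits
are mutually singular. -/
lemma mutuallySingular_of_isMixingSeq {μ ν : Measure E} [IsProbabilityMeasure μ]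
    [IsProbabilityMeasure ν] {c : ℕ → E → ℝ} {p q : ℝ} (hpq : p ≠ q)
    (hμ : IsMixingSeq μ c p) (hν : IsMixingSeq ν c q) (hc : ∀ k, Measurable (c k))
    (hb : ∀ k x, |c k x| ≤ 1) : μ ⟂ₘ ν := by
  set lam : Measure E := μ + ν with hlam
  have hμl : μ ≤ lam := Measure.le_add_right le_rfl
  have hνl : ν ≤ lam := Measure.le_add_left le_rfl
  have hμa := hμl.absolutelyContinuous
  have hνa := hνl.absolutelyContinuous
  set f : E → ℝ := fun x => (μ.rnDeriv lam x).toReal with hf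
  set g : E → ℝ := fun x => (ν.rnDeriv lam x).toReal with hg
  have hfm : Measurable f := (Measure.measurable_rnDeriv _ _).ennreal_toReal
  have hgm : Measurable g := (Measure.measurable_rnDeriv _ _).ennreal_toReal
  have bound : ∀ {ρ : Measure E} [IsProbabilityMeasure ρ], ρ ≤ lam →
      ∀ᵐ x ∂lam, |(ρ.rnDeriv lam x).toReal| ≤ 1 := by
    intro ρ _ hρ
    filter_upwards [Measure.rnDeriv_le_one_of_le hρ] with x hx
    rw [abs_of_nonneg ENNReal.toReal_nonneg]
    exact ENNReal.toReal_le_of_le_ofReal zero_le_one (by simpa using hx)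
  have hf1 := bound hμl
  have hg1 := bound hνl
  have eμ : ∀ φ : E → ℝ, ∫ x, f x * φ x ∂lam = ∫ x, φ x ∂μ := fun φ => by
    simpa [smul_eq_mul] using integral_rnDeriv_smul hμa (f := φ)
  have eν : ∀ φ : E → ℝ, ∫ x, g x * φ x ∂lam = ∫ x, φ x ∂ν := fun φ => by
    simpa [smul_eq_mul] using integral_rnDeriv_smul hνa (f := φ)
  have l1 := hμ.tendsto_integral_mul hc hb hgm (hμa.ae_le hg1)
  have l2 := hν.tendsto_integral_mul hc hb hfm (hνa.ae_le hf1)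
  have e1 : ∀ k, ∫ x, c k x * g x ∂μ = ∫ x, c k x * f x ∂ν := fun k => by
    rw [← eμ, ← eν]
    exact integral_congr_ae (ae_of_all _ fun x => by ring)
  have e2 : ∫ x, g x ∂μ = ∫ x, f x ∂ν := by
    rw [← eμ, ← eν]
    exact integral_congr_ae (ae_of_all _ fun x => by ring)
  simp_rw [e1, e2] at l1
  have h0 : ∫ x, f x ∂ν = 0 := by
    have := tendsto_nhds_unique l1 l2
    by_contra hne
    exact hpq (mul_right_cancel₀ hne this)
  rw [← eν] at h0
  have hfg : (fun x => g x * f x) =ᵐ[lam] 0 := by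
    rw [integral_eq_zero_iff_of_nonneg] at h0
    · exact h0
    · exact fun x => mul_nonneg ENNReal.toReal_nonneg ENNReal.toReal_nonneg
    · refine Integrable.of_bound (hgm.mul hfm).aestronglyMeasurable 1 ?_
      filter_upwards [hf1, hg1] with x h1 h2
      rw [Real.norm_eq_abs, abs_mul]
      exact mul_le_one₀ h2 (abs_nonneg _) h1
  refine ⟨{x | μ.rnDeriv lam x = 0}, Measure.measurable_rnDeriv _ _ (measurableSet_singleton 0),
    ?_, ?_⟩
  · have := Measure.rnDeriv_pos hμa
    rw [ae_iff] at this
    simpa using this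
  · have hpos := Measure.rnDeriv_pos hνa
    have : ∀ᵐ x ∂ν, μ.rnDeriv lam x = 0 := by
      filter_upwards [hpos, hνa.ae_le hfg, hνa.ae_le (Measure.rnDeriv_lt_top μ lam),
        hνa.ae_le (Measure.rnDeriv_lt_top ν lam)] with x h1 h2 h3 h4
      simp only [Pi.zero_apply, mul_eq_zero, hf, hg, ENNReal.toReal_eq_zero_iff] at h2
      rcases h2 with (h2 | h2) | (h2 | h2)
      · exact absurd h2 h1.ne'
      · exact absurd h2 h4.ne
      · exact h2
      · exact absurd h2 h3.ne
    rw [ae_iff] at this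
    exact this

end Mixing

section Stieltjes

/-- The `i`-th point of the uniform partition of `[a,b]` into `n` intervals. -/
def gridPoint (a b : ℝ) (n i : ℕ) : ℝ := a + (b - a) * i / n

lemma gridPoint_zero (a b : ℝ) (n : ℕ) : gridPoint a b n 0 = a := by simp [gridPoint]

lemma gridPoint_last (a b : ℝ) {n : ℕ} (hn : n ≠ 0) : gridPoint a b n n = b := by
  have : (n : ℝ) ≠ 0 := by exact_mod_cast hn
  unfold gridPoint
  field_simp
  ring

lemma gridPoint_mono {a b : ℝ} (hab : a ≤ b) (n : ℕ) : Monotone (gridPoint a b n) := by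
  intro i j hij
  have h : (i : ℝ) ≤ j := by exact_mod_cast hij
  have h' : 0 ≤ b - a := by linarith
  unfold gridPoint
  gcongr

lemma gridPoint_succ_sub (a b : ℝ) (n i : ℕ) :
    gridPoint a b n (i + 1) - gridPoint a b n i = (b - a) / n := by
  unfold gridPoint
  push_cast
  ring

lemma gridPoint_mem {a b : ℝ} (hab : a ≤ b) {n i : ℕ} (hi : i ≤ n) :
    gridPoint a b n i ∈ Set.Icc a b := by
  rcases Nat.eq_zero_or_pos n with rfl | hn
  · obtain rfl : i = 0 := by omega
    rw [gridPoint_zero]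
    exact ⟨le_rfl, hab⟩
  · constructor
    · exact (gridPoint_zero a b n).symm.le.trans (gridPoint_mono hab n (Nat.zero_le i))
    · exact (gridPoint_mono hab n hi).trans (gridPoint_last a b hn.ne').le

/-- Convergence of Riemann–Stieltjes sums with a continuously differentiable integrator. -/
lemma tendsto_stieltjes_sum {a b : ℝ} (hab : a ≤ b) {φ φ' G : ℝ → ℝ}
    (hφ : ∀ x ∈ Set.Icc a b, HasDerivAt φ (φ' x) x) (hφ' : ContinuousOn φ' (Set.Icc a b))
    (hG : ContinuousOn G (Set.Icc a b)) (ξ : ℕ → ℕ → ℝ)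
    (hξ : ∀ n, ∀ i < n, ξ n i ∈ Set.Icc (gridPoint a b n i) (gridPoint a b n (i + 1))) :
    Tendsto (fun n => ∑ i ∈ Finset.range n,
      (φ (gridPoint a b n (i + 1)) - φ (gridPoint a b n i)) * G (ξ n i)) atTop
      (𝓝 (∫ u in a..b, φ' u * G u)) := by
  obtain ⟨M, hM⟩ := isCompact_Icc.exists_bound_of_continuousOn hφ'
  have hM0 : 0 ≤ M := (norm_nonneg _).trans (hM a ⟨le_rfl, hab⟩)
  have hunif := isCompact_Icc.uniformContinuousOn_of_continuous hG
  rw [Metric.tendsto_atTop]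
  intro ε hε
  set δ := ε / (2 * (M * (b - a) + 1)) with hδ
  have hba : 0 ≤ b - a := by linarith
  have hden : 0 < M * (b - a) + 1 := by positivity
  have hδ0 : 0 < δ := by positivity
  obtain ⟨η, hη, hηG⟩ := Metric.uniformContinuousOn_iff.1 hunif δ hδ0
  obtain ⟨N, hN⟩ := exists_nat_gt ((b - a) / η)
  refine ⟨N + 1, fun n hn => ?_⟩
  have hn0 : n ≠ 0 := by omega
  have hnpos : (0 : ℝ) < n := by exact_mod_cast Nat.pos_of_ne_zero hn0
  have hmesh : (b - a) / n < η := by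
    have : (N : ℝ) ≤ n := by exact_mod_cast (by omega : N ≤ n)
    rw [div_lt_iff₀ hnpos]
    rw [div_lt_iff₀ hη] at hN
    nlinarith
  have hsubset : ∀ i < n, Set.uIcc (gridPoint a b n i) (gridPoint a b n (i + 1)) ⊆ Set.Icc a b := by
    intro i hi
    rw [Set.uIcc_of_le (gridPoint_mono hab n (Nat.le_succ i))]
    exact Set.Icc_subset_Icc (gridPoint_mem hab hi.le).1 (gridPoint_mem hab hi).2
  have hint : ∀ i < n, IntervalIntegrable (fun u => φ' u * G u) volume
      (gridPoint a b n i) (gridPoint a b n (i + 1)) := fun i hi =>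
    ((hφ'.mul hG).mono (hsubset i hi)).intervalIntegrable
  have hsplit : ∫ u in a..b, φ' u * G u = ∑ i ∈ Finset.range n,
      ∫ u in gridPoint a b n i..gridPoint a b n (i + 1), φ' u * G u := by
    rw [intervalIntegral.sum_integral_adjacent_intervals hint, gridPoint_zero,
      gridPoint_last a b hn0]
  have hterm : ∀ i ∈ Finset.range n,
      ‖(φ (gridPoint a b n (i + 1)) - φ (gridPoint a b n i)) * G (ξ n i) -
        ∫ u in gridPoint a b n i..gridPoint a b n (i + 1), φ' u * G u‖ ≤
      M * δ * ((b - a) / n) := by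
    intro i hi
    rw [Finset.mem_range] at hi
    have hφi : IntervalIntegrable φ' volume (gridPoint a b n i) (gridPoint a b n (i + 1)) :=
      (hφ'.mono (hsubset i hi)).intervalIntegrable
    rw [← intervalIntegral.integral_eq_sub_of_hasDerivAt
      (fun x hx => hφ x (hsubset i hi hx)) hφi, ← intervalIntegral.integral_mul_const,
      ← intervalIntegral.integral_sub (hφi.mul_const _) (hint i hi)]
    have habs : |gridPoint a b n (i + 1) - gridPoint a b n i| = (b - a) / n := by
      rw [gridPoint_succ_sub, abs_of_nonneg (by positivity)]
    rw [← habs]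
    refine intervalIntegral.norm_integral_le_of_norm_le_const fun u hu => ?_
    rw [← mul_sub, norm_mul]
    have hu' := Set.uIoc_subset_uIcc hu
    have huI := hsubset i hi hu'
    rw [Set.uIcc_of_le (gridPoint_mono hab n (Nat.le_succ i))] at hu'
    have hξI : ξ n i ∈ Set.Icc a b := hsubset i hi (by
      rw [Set.uIcc_of_le (gridPoint_mono hab n (Nat.le_succ i))]; exact hξ n i hi)
    refine mul_le_mul (hM u huI) ?_ (norm_nonneg _) hM0
    rw [← dist_eq_norm]
    refine (hηG _ hξI _ huI ?_).le
    rw [Real.dist_eq]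
    have hs := gridPoint_succ_sub a b n i
    have := hξ n i hi
    exact (abs_sub_le_iff.2 ⟨by linarith [this.2, hu'.1], by linarith [this.1, hu'.2]⟩).trans_lt
      hmesh
  rw [hsplit, dist_eq_norm, ← Finset.sum_sub_distrib]
  refine (norm_sum_le_of_le _ hterm).trans_lt ?_
  rw [Finset.sum_const, Finset.card_range, nsmul_eq_mul]
  have e : (n : ℝ) * (M * δ * ((b - a) / n)) = M * (b - a) * δ := by field_simp
  rw [e, hδ, mul_div_assoc', div_lt_iff₀ (by positivity)]
  nlinarith [mul_nonneg hM0 hba]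

end Stieltjes

section WienerIntegral

/-- Left-point Riemann sums for the Wiener integral of `g` over `[a,b]`. -/
def wienerSum (B : ℝ → Ω → ℝ) (g : ℝ → ℝ) (a b : ℝ) (n : ℕ) (ω : Ω) : ℝ :=
  ∑ i ∈ Finset.range n, g (gridPoint a b n i) *
    (B (gridPoint a b n (i + 1)) ω - B (gridPoint a b n i) ω)

/-- The Wiener integral of `g` over `[a,b]`, integrated by parts; `g'` is the derivative of `g`. -/
def wienerIntegral (B : ℝ → Ω → ℝ) (g g' : ℝ → ℝ) (a b : ℝ) (ω : Ω) : ℝ :=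
  g b * B b ω - g a * B a ω - ∫ u in a..b, g' u * B u ω

lemma tendsto_wienerSum {E : Type*} {B : ℝ → E → ℝ} {g g' : ℝ → ℝ} {a b : ℝ} (hab : a ≤ b)
    (hg : ∀ x ∈ Set.Icc a b, HasDerivAt g (g' x) x) (hg' : ContinuousOn g' (Set.Icc a b))
    {ω : E} (hω : Continuous fun t => B t ω) :
    Tendsto (fun n => wienerSum B g a b n ω) atTop (𝓝 (wienerIntegral B g g' a b ω)) := by
  have h := tendsto_stieltjes_sum hab hg hg' (G := fun t => B t ω) hω.continuousOn
    (fun n i => gridPoint a b n (i + 1))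
    (fun n i _ => ⟨gridPoint_mono hab n (Nat.le_succ i), le_rfl⟩)
  refine (h.const_sub (g b * B b ω - g a * B a ω)).congr' ?_
  filter_upwards [eventually_ne_atTop 0] with n hn
  have htel := Finset.sum_range_sub
    (fun i => g (gridPoint a b n i) * B (gridPoint a b n i) ω) n
  rw [gridPoint_zero, gridPoint_last a b hn] at htel
  rw [← htel, ← Finset.sum_sub_distrib]
  exact Finset.sum_congr rfl fun i _ => by ring

lemma tendsto_sum_sq_mul_gridPoint {g : ℝ → ℝ} {a b : ℝ} (hab : a ≤ b)
    (hg : ContinuousOn g (Set.Icc a b)) :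
    Tendsto (fun n => ∑ i ∈ Finset.range n, g (gridPoint a b n i) ^ 2 *
      (gridPoint a b n (i + 1) - gridPoint a b n i)) atTop (𝓝 (∫ u in a..b, g u ^ 2)) := by
  have h := tendsto_stieltjes_sum hab (φ := id) (φ' := fun _ => 1) (G := fun t => g t ^ 2)
    (fun x _ => hasDerivAt_id x) continuousOn_const (hg.pow 2)
    (fun n i => gridPoint a b n i)
    (fun n i _ => ⟨le_rfl, gridPoint_mono hab n (Nat.le_succ i)⟩)
  simp only [one_mul, id] at h
  exact h.congr fun n => Finset.sum_congr rfl fun i _ => mul_comm _ _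

/-- The σ-algebra generated by the process on `[0,s]`. -/
@[reducible] def pastSigma (B : ℝ → Ω → ℝ) (s : ℝ) : MeasurableSpace Ω :=
  MeasurableSpace.comap (fun ω (u : Set.Icc (0:ℝ) s) => B u.1 ω) inferInstance

lemma measurable_pastSigma {E : Type*} (B : ℝ → E → ℝ) {s u : ℝ}
    (hu : u ∈ Set.Icc 0 s) :
    Measurable[pastSigma B s] (B u) := by
  have h : Measurable[pastSigma B s] (fun ω (u : Set.Icc (0:ℝ) s) => B u.1 ω) :=
    comap_measurable _
  exact (measurable_pi_apply (⟨u, hu⟩ : Set.Icc (0:ℝ) s)).comp h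

lemma pastSigma_mono {E : Type*} (B : ℝ → E → ℝ) {s t : ℝ} (hst : s ≤ t) :
    pastSigma B s ≤ pastSigma B t := by
  rw [pastSigma, ← measurable_iff_comap_le]
  refine @measurable_pi_lambda _ _ _ (_) _ _ fun u => ?_
  exact measurable_pastSigma B ⟨u.2.1, u.2.2.trans hst⟩

lemma IsStandardWiener.pastSigma_le {P : Measure Ω} {B : ℝ → Ω → ℝ} (hB : IsStandardWiener P B)
    (s : ℝ) : pastSigma B s ≤ ‹MeasurableSpace Ω› := by
  rw [pastSigma, ← measurable_iff_comap_le]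
  exact measurable_pi_lambda _ fun u => hB.meas _

lemma IsStandardWiener.integral_cexp_increment {P : Measure Ω} {B : ℝ → Ω → ℝ}
    (hB : IsStandardWiener P B) {s t : ℝ} (hs : 0 ≤ s) (hst : s ≤ t) (c : ℝ) :
    ∫ ω, Complex.exp (((c * (B t ω - B s ω) : ℝ) : ℂ) * Complex.I) ∂P =
      Complex.exp ((-(c ^ 2 * (t - s)) / 2 : ℝ) : ℂ) := by
  have h1 := charFun_gaussianReal (μ := 0) (v := Real.toNNReal (t - s)) c
  rw [← hB.incr_law s t hs hst, charFun_apply_real, integral_map] at h1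
  · simp only [Complex.ofReal_mul, Complex.ofReal_sub] at h1 ⊢
    rw [h1]
    have : ((t - s).toNNReal : ℝ) = t - s := Real.coe_toNNReal _ (by linarith)
    rw [this]
    push_cast
    congr 1
    ring
  · exact ((hB.meas t).sub (hB.meas s)).aemeasurable
  · fun_prop

lemma IsStandardWiener.integral_mul_cexp_increment {P : Measure Ω} {B : ℝ → Ω → ℝ}
    (hB : IsStandardWiener P B) {s t : ℝ} (hs : 0 ≤ s) (hst : s ≤ t) (c : ℝ) {Z : Ω → ℂ}
    (hZ : Measurable[pastSigma B s] Z) :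
    ∫ ω, Z ω * Complex.exp (((c * (B t ω - B s ω) : ℝ) : ℂ) * Complex.I) ∂P =
      (∫ ω, Z ω ∂P) * Complex.exp ((-(c ^ 2 * (t - s)) / 2 : ℝ) : ℂ) := by
  have hm : Measurable fun x : ℝ => Complex.exp (((c * x : ℝ) : ℂ) * Complex.I) := by fun_prop
  have hind : IndepFun Z
      (fun ω => Complex.exp (((c * (B t ω - B s ω) : ℝ) : ℂ) * Complex.I)) P := by
    have h := ((hB.incr_indep s t hs hst).symm.comp measurable_id hm)
    rw [IndepFun_iff_Indep] at h ⊢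
    exact indep_of_indep_of_le_left h hZ.comap_le
  rw [hind.integral_fun_mul_eq_mul_integral (hZ.mono (hB.pastSigma_le s) le_rfl).aestronglyMeasurable
    (hm.comp ((hB.meas t).sub (hB.meas s))).aestronglyMeasurable,
    hB.integral_cexp_increment hs hst]

lemma IsStandardWiener.integral_mul_cexp_sum {P : Measure Ω} {B : ℝ → Ω → ℝ}
    (hB : IsStandardWiener P B) {s : ℕ → ℝ} (hs0 : 0 ≤ s 0) (hs : Monotone s) (c : ℕ → ℝ)
    {Z : Ω → ℂ} (hZ : Measurable[pastSigma B (s 0)] Z) (n : ℕ) :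
    ∫ ω, Z ω * Complex.exp (((∑ i ∈ Finset.range n, c i * (B (s (i + 1)) ω - B (s i) ω) : ℝ) : ℂ)
      * Complex.I) ∂P =
    (∫ ω, Z ω ∂P) *
      Complex.exp ((-(∑ i ∈ Finset.range n, c i ^ 2 * (s (i + 1) - s i)) / 2 : ℝ) : ℂ) := by
  induction n with
  | zero => simp
  | succ n ih =>
    have hsum : Measurable[pastSigma B (s n)] fun ω =>
        ∑ i ∈ Finset.range n, c i * (B (s (i + 1)) ω - B (s i) ω) := by
      refine @Finset.measurable_fun_sum _ _ _ _ _ _ (pastSigma B (s n)) _ _ fun i hi => ?_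
      have hi := Finset.mem_range.1 hi
      have h0 : ∀ j, 0 ≤ s j := fun j => hs0.trans (hs (Nat.zero_le j))
      exact ((measurable_pastSigma B ⟨h0 _, hs hi⟩).sub
        (measurable_pastSigma B ⟨h0 _, hs hi.le⟩)).const_mul (c i)
    have hm : Measurable fun x : ℝ => Complex.exp ((x : ℂ) * Complex.I) := by fun_prop
    have hZ' : Measurable[pastSigma B (s n)] fun ω => Z ω * Complex.exp
        (((∑ i ∈ Finset.range n, c i * (B (s (i + 1)) ω - B (s i) ω) : ℝ) : ℂ) * Complex.I) :=
      (hZ.mono (pastSigma_mono B (hs (Nat.zero_le n))) le_rfl).mul (hm.comp hsum)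
    have h := hB.integral_mul_cexp_increment (hs0.trans (hs (Nat.zero_le n))) (hs (Nat.le_succ n))
      (c n) hZ'
    rw [ih] at h
    simp_rw [Finset.sum_range_succ]
    rw [mul_assoc, ← Complex.exp_add, Nat.succ_eq_add_one] at h
    convert h using 2
    · ext ω
      rw [mul_assoc, ← Complex.exp_add]
      push_cast
      ring_nf
    · push_cast
      ring_nf

/-- The joint characteristic function of Wiener integrals over `[0,s]` and `[s,t]`. -/
lemma IsStandardWiener.integral_cexp_wienerIntegral {P : Measure Ω} [IsProbabilityMeasure P]
    {B : ℝ → Ω → ℝ} (hB : IsStandardWiener P B) {s t : ℝ} (hs : 0 ≤ s) (hst : s ≤ t)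
    {g g' : ℝ → ℝ} (hg : ∀ x ∈ Set.Icc 0 t, HasDerivAt g (g' x) x)
    (hg' : ContinuousOn g' (Set.Icc 0 t)) (x y : ℝ) :
    ∫ ω, Complex.exp (((x * wienerIntegral B g g' 0 s ω + y * wienerIntegral B g g' s t ω : ℝ) : ℂ)
      * Complex.I) ∂P =
    Complex.exp ((-(x ^ 2 * (∫ u in (0:ℝ)..s, g u ^ 2) + y ^ 2 * (∫ u in s..t, g u ^ 2)) / 2 : ℝ)
      : ℂ) := by
  have hsub1 : Set.Icc 0 s ⊆ Set.Icc 0 t := Set.Icc_subset_Icc_right hst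
  have hsub2 : Set.Icc s t ⊆ Set.Icc 0 t := Set.Icc_subset_Icc_left hs
  have hgc : ContinuousOn g (Set.Icc 0 t) := fun u hu => (hg u hu).continuousAt.continuousWithinAt
  have hmeas : ∀ a b n, Measurable (wienerSum B g a b n) := fun a b n =>
    Finset.measurable_fun_sum _ fun i _ => ((hB.meas _).sub (hB.meas _)).const_mul _
  have hfin : ∀ n, ∫ ω, Complex.exp (((x * wienerSum B g 0 s n ω + y * wienerSum B g s t n ω : ℝ)
      : ℂ) * Complex.I) ∂P = Complex.exp ((-(x ^ 2 * (∑ i ∈ Finset.range n,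
        g (gridPoint 0 s n i) ^ 2 * (gridPoint 0 s n (i + 1) - gridPoint 0 s n i)) +
        y ^ 2 * (∑ i ∈ Finset.range n,
        g (gridPoint s t n i) ^ 2 * (gridPoint s t n (i + 1) - gridPoint s t n i))) / 2 : ℝ)
      : ℂ) := by
    intro n
    have h1 := hB.integral_mul_cexp_sum (gridPoint_zero 0 s n).ge (gridPoint_mono hs n)
      (fun i => x * g (gridPoint 0 s n i)) (Z := fun _ => 1) measurable_const n
    have hm : Measurable fun x : ℝ => Complex.exp ((x : ℂ) * Complex.I) := by fun_prop
    have hpast : Measurable[pastSigma B (gridPoint s t n 0)] fun ω =>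
        ∑ i ∈ Finset.range n, x * g (gridPoint 0 s n i) *
          (B (gridPoint 0 s n (i + 1)) ω - B (gridPoint 0 s n i) ω) := by
      rw [gridPoint_zero]
      refine @Finset.measurable_fun_sum _ _ _ _ _ _ (pastSigma B s) _ _ fun i hi => ?_
      have hi := Finset.mem_range.1 hi
      exact ((measurable_pastSigma B (gridPoint_mem hs hi)).sub
        (measurable_pastSigma B (gridPoint_mem hs hi.le))).const_mul _
    have h2 := hB.integral_mul_cexp_sum (hs.trans (gridPoint_zero s t n).ge) (gridPoint_mono hst n)
      (fun i => y * g (gridPoint s t n i)) (hm.comp hpast) n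
    simp only [Function.comp_def] at h2
    simp only [one_mul, integral_const, probReal_univ, one_smul] at h1
    rw [h1, ← Complex.exp_add, ← Complex.ofReal_add] at h2
    convert h2 using 2
    · ext ω
      rw [← Complex.exp_add, ← add_mul, ← Complex.ofReal_add]
      simp only [wienerSum, Finset.mul_sum, mul_assoc]
    · simp only [Finset.mul_sum, mul_pow, mul_assoc]
      congr 1
      ring
  have hlim1 : Tendsto (fun n => ∫ ω, Complex.exp (((x * wienerSum B g 0 s n ω +
      y * wienerSum B g s t n ω : ℝ) : ℂ) * Complex.I) ∂P) atTop
      (𝓝 (∫ ω, Complex.exp (((x * wienerIntegral B g g' 0 s ω + y * wienerIntegral B g g' s t ω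
        : ℝ) : ℂ) * Complex.I) ∂P)) := by
    refine tendsto_integral_of_dominated_convergence (fun _ => 1) (fun n => ?_)
      (integrable_const 1) (fun n => ae_of_all _ fun ω => ?_) ?_
    · have := hmeas 0 s n
      have := hmeas s t n
      exact Measurable.aestronglyMeasurable (by fun_prop)
    · rw [Complex.norm_exp_ofReal_mul_I]
    · filter_upwards [hB.cont] with ω hω
      have l1 := tendsto_wienerSum hs (fun u hu => hg u (hsub1 hu)) (hg'.mono hsub1) hω
      have l2 := tendsto_wienerSum hst (fun u hu => hg u (hsub2 hu)) (hg'.mono hsub2) hω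
      have hc : Continuous fun x : ℝ => Complex.exp ((x : ℂ) * Complex.I) := by fun_prop
      exact (hc.tendsto _).comp ((l1.const_mul x).add (l2.const_mul y))
  simp_rw [hfin] at hlim1
  refine tendsto_nhds_unique hlim1 ?_
  have hc : Continuous fun x : ℝ => Complex.exp ((-x / 2 : ℝ) : ℂ) := by fun_prop
  exact (hc.tendsto _).comp
    (((tendsto_sum_sq_mul_gridPoint hs (hgc.mono hsub1)).const_mul (x ^ 2)).add
      ((tendsto_sum_sq_mul_gridPoint hst (hgc.mono hsub2)).const_mul (y ^ 2)))

end WienerIntegral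

section Bridge

/-- The kernel `u ↦ (T-u)^(-α)` whose Wiener integral drives the `α`-Wiener bridge. -/
def bridgeKernel (T α u : ℝ) : ℝ := (T - u) ^ (-α)

/-- The derivative of `bridgeKernel`. -/
def bridgeKernelDeriv (T α u : ℝ) : ℝ := α * (T - u) ^ (-α - 1)

/-- The quadratic variation at time `t` of the Wiener integral of `bridgeKernel`. -/
def bridgeClock (T α t : ℝ) : ℝ := ∫ u in (0:ℝ)..t, bridgeKernel T α u ^ 2

variable {T : ℝ}

lemma hasDerivAt_bridgeKernel (α : ℝ) {u : ℝ} (hu : u < T) :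
    HasDerivAt (bridgeKernel T α) (bridgeKernelDeriv T α u) u := by
  have h := ((hasDerivAt_id u).const_sub T).rpow_const (p := -α) (Or.inl (sub_pos.2 hu).ne')
  have h' : HasDerivAt (fun y => (T - y) ^ (-α)) (α * (T - u) ^ (-α - 1)) u := by simpa using h
  exact h'

lemma continuousOn_sub_rpow (r : ℝ) : ContinuousOn (fun u : ℝ => (T - u) ^ r) (Set.Iio T) :=
  (continuousOn_const.sub continuousOn_id).rpow_const fun _ hu => Or.inl (sub_pos.2 hu).ne'

lemma continuousOn_bridgeKernelDeriv (α : ℝ) :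
    ContinuousOn (bridgeKernelDeriv T α) (Set.Iio T) :=
  continuousOn_const.mul (continuousOn_sub_rpow _)

lemma intervalIntegrable_bridgeKernel_sq (α : ℝ) {s t : ℝ} (hs : s < T) (ht : t < T) :
    IntervalIntegrable (fun u => bridgeKernel T α u ^ 2) volume s t :=
  (((continuousOn_sub_rpow _).pow 2).mono fun _ hu =>
    (le_sup_iff.1 hu.2).elim (fun h => h.trans_lt hs) (fun h => h.trans_lt ht)).intervalIntegrable

lemma bridgeClock_sub (α : ℝ) (hT : 0 < T) {s t : ℝ} (hs : s < T) (ht : t < T) :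
    bridgeClock T α t - bridgeClock T α s = ∫ u in s..t, bridgeKernel T α u ^ 2 :=
  intervalIntegral.integral_interval_sub_left (intervalIntegrable_bridgeKernel_sq α hT ht)
    (intervalIntegrable_bridgeKernel_sq α hT hs)

lemma wienerIntegral_add {E : Type*} {B : ℝ → E → ℝ} (α : ℝ) {r s t : ℝ} (hr : r < T) (hs : s < T)
    (ht : t < T) {ω : E} (hω : Continuous fun t => B t ω) :
    wienerIntegral B (bridgeKernel T α) (bridgeKernelDeriv T α) r s ω +
      wienerIntegral B (bridgeKernel T α) (bridgeKernelDeriv T α) s t ω =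
      wienerIntegral B (bridgeKernel T α) (bridgeKernelDeriv T α) r t ω := by
  have hi : ∀ a b : ℝ, a < T → b < T →
      IntervalIntegrable (fun u => bridgeKernelDeriv T α u * B u ω) volume a b := fun a b ha hb =>
    (((continuousOn_bridgeKernelDeriv α).mul hω.continuousOn).mono fun _ hu =>
      (le_sup_iff.1 hu.2).elim (fun h => h.trans_lt ha)
        (fun h => h.trans_lt hb)).intervalIntegrable
  unfold wienerIntegral
  rw [← intervalIntegral.integral_add_adjacent_intervals (hi r s hr hs) (hi s t hs ht)]
  ring

lemma alphaWienerBridge_eq {E : Type*} {B : ℝ → E → ℝ} (α : ℝ) {t : ℝ} (ht : t ∈ Set.Ico 0 T)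
    {ω : E}
    (h0 : B 0 ω = 0) : alphaWienerBridge T α B t ω =
      (T - t) ^ α * wienerIntegral B (bridgeKernel T α) (bridgeKernelDeriv T α) 0 t ω := by
  have hpos : 0 < T - t := sub_pos.2 ht.2
  have hK : (T - t) ^ α * (T - t) ^ (-α) = 1 := by
    rw [← Real.rpow_add hpos, add_neg_cancel, Real.rpow_zero]
  unfold alphaWienerBridge wienerIntegral bridgeKernelDeriv
  rw [intervalIntegral.integral_of_le ht.1, h0]
  simp_rw [mul_assoc α]
  rw [integral_const_mul]
  unfold bridgeKernel
  linear_combination (-B t ω) * hK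

lemma continuousOn_alphaWienerBridge {E : Type*} {B : ℝ → E → ℝ} (α : ℝ) {ω : E}
    (hω : Continuous fun t => B t ω) :
    ContinuousOn (fun t => alphaWienerBridge T α B t ω) (Set.Ico 0 T) := by
  have hint : ContinuousOn (fun t => ∫ s in Set.Ioc (0:ℝ) t, (T - s) ^ (-α - 1) * B s ω)
      (Set.Ico 0 T) := by
    intro t ht
    obtain ⟨b, htb, hbT⟩ := exists_between ht.2
    have hI : IntegrableOn (fun s => (T - s) ^ (-α - 1) * B s ω) (Set.Icc 0 b) :=
      (((continuousOn_sub_rpow _).mul hω.continuousOn).mono fun u hu =>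
        hu.2.trans_lt hbT).integrableOn_Icc
    refine (intervalIntegral.continuousOn_primitive hI t ⟨ht.1, htb.le⟩).mono_of_mem_nhdsWithin ?_
    filter_upwards [self_mem_nhdsWithin, mem_nhdsWithin_of_mem_nhds (Iio_mem_nhds htb)] with u h1 h2
    exact ⟨h1.1, le_of_lt h2⟩
  unfold alphaWienerBridge
  have hK : ContinuousOn (fun u : ℝ => (T - u) ^ α) (Set.Ico 0 T) :=
    (continuousOn_sub_rpow α).mono fun u hu => hu.2
  exact hω.continuousOn.sub ((continuousOn_const.mul hK).mul hint)

lemma IsStandardWiener.aemeasurable_alphaWienerBridge {P : Measure Ω} {B : ℝ → Ω → ℝ}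
    (hB : IsStandardWiener P B) (α : ℝ) {t : ℝ} (ht : t ∈ Set.Ico 0 T) :
    AEMeasurable (alphaWienerBridge T α B t) P := by
  refine aemeasurable_of_tendsto_metrizable_ae atTop
    (f := fun n ω => (T - t) ^ α * wienerSum B (bridgeKernel T α) 0 t n ω) (fun n => ?_) ?_
  · refine Measurable.aemeasurable (Measurable.const_mul ?_ _)
    exact Finset.measurable_fun_sum _ fun i _ => ((hB.meas _).sub (hB.meas _)).const_mul _
  · filter_upwards [hB.cont, hB.init] with ω hω h0
    rw [alphaWienerBridge_eq α ht h0]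
    exact (tendsto_wienerSum ht.1 (fun u hu => hasDerivAt_bridgeKernel α (hu.2.trans_lt ht.2))
      ((continuousOn_bridgeKernelDeriv α).mono fun u hu => hu.2.trans_lt ht.2) hω).const_mul _

lemma IsStandardWiener.integral_cos_bridge {P : Measure Ω} [IsProbabilityMeasure P]
    {B : ℝ → Ω → ℝ} (hB : IsStandardWiener P B) (α : ℝ) (hT : 0 < T) {s t : ℝ} (hs : 0 ≤ s)
    (hst : s ≤ t) (ht : t < T) (a b : ℝ) :
    ∫ ω, Real.cos (a * alphaWienerBridge T α B s ω + b * alphaWienerBridge T α B t ω) ∂P =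
      Real.exp (-((a * (T - s) ^ α + b * (T - t) ^ α) ^ 2 * bridgeClock T α s +
        (b * (T - t) ^ α) ^ 2 * (bridgeClock T α t - bridgeClock T α s)) / 2) := by
  have hsT := hst.trans_lt ht
  have h := hB.integral_cexp_wienerIntegral hs hst (g := bridgeKernel T α)
    (fun u hu => hasDerivAt_bridgeKernel α (hu.2.trans_lt ht))
    ((continuousOn_bridgeKernelDeriv α).mono fun u hu => hu.2.trans_lt ht)
    (a * (T - s) ^ α + b * (T - t) ^ α) (b * (T - t) ^ α)
  rw [← bridgeClock_sub α hT hsT ht] at h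
  change _ = Complex.exp ((-((a * (T - s) ^ α + b * (T - t) ^ α) ^ 2 * bridgeClock T α s +
        (b * (T - t) ^ α) ^ 2 * (bridgeClock T α t - bridgeClock T α s)) / 2 : ℝ) : ℂ) at h
  rw [integral_congr_ae (g := fun ω => Complex.exp (((a * alphaWienerBridge T α B s ω +
    b * alphaWienerBridge T α B t ω : ℝ) : ℂ) * Complex.I))] at h
  · have h2 := congrArg Complex.re h
    rw [← Complex.ofReal_exp, Complex.ofReal_re] at h2
    rw [← h2]
    have hX := (hB.aemeasurable_alphaWienerBridge α ⟨hs, hsT⟩).const_mul a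
    have hY := (hB.aemeasurable_alphaWienerBridge α ⟨hs.trans hst, ht⟩).const_mul b
    have hm : Measurable fun x : ℝ => Complex.exp ((x : ℂ) * Complex.I) := by fun_prop
    have hi : Integrable (fun ω => Complex.exp (((a * alphaWienerBridge T α B s ω +
        b * alphaWienerBridge T α B t ω : ℝ) : ℂ) * Complex.I)) P :=
      Integrable.of_bound (hm.comp_aemeasurable (hX.add hY)).aestronglyMeasurable 1
        (ae_of_all _ fun ω => by rw [Complex.norm_exp_ofReal_mul_I])
    have h3 := integral_re hi
    simp only [RCLike.re_eq_complex_re, Complex.exp_ofReal_mul_I_re] at h3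
    exact h3
  · filter_upwards [hB.cont, hB.init] with ω hω h0
    rw [alphaWienerBridge_eq α ⟨hs, hsT⟩ h0, alphaWienerBridge_eq α ⟨hs.trans hst, ht⟩ h0,
      ← wienerIntegral_add α hT hsT ht hω]
    congr 3
    ring

/-- The law of the `α`-Wiener bridge sampled along a sequence of times. -/
def sampledLaw (P : Measure Ω) (T α : ℝ) (B : ℝ → Ω → ℝ) (t : ℕ → ℝ) : Measure (ℕ → ℝ) :=
  P.map fun ω k => alphaWienerBridge T α B (t k) ω

lemma IsStandardWiener.aemeasurable_sample {P : Measure Ω} {B : ℝ → Ω → ℝ}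
    (hB : IsStandardWiener P B) (α : ℝ) {t : ℕ → ℝ} (ht : ∀ k, t k ∈ Set.Ico 0 T) :
    AEMeasurable (fun ω k => alphaWienerBridge T α B (t k) ω) P :=
  aemeasurable_pi_lambda _ fun k => hB.aemeasurable_alphaWienerBridge α (ht k)

/-- Under the law of the sampled bridge, cosines of the coordinates form a mixing sequence as soon
as the corresponding Gaussian variances behave suitably. -/
lemma IsStandardWiener.isMixingSeq_sampledLaw {P : Measure Ω} [IsProbabilityMeasure P]
    {B : ℝ → Ω → ℝ} (hB : IsStandardWiener P B) (α : ℝ) (hT : 0 < T) {t : ℕ → ℝ}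
    (ht : ∀ k, t k ∈ Set.Ico 0 T) (hmono : Monotone t) (f : ℕ → ℝ) {m J : ℕ → ℝ}
    (hm : ∀ k, m k = f k * (T - t k) ^ α) (hJ : ∀ k, J k = bridgeClock T α (t k)) {p : ℝ}
    (hmean : Tendsto (fun k => Real.exp (-(m k ^ 2 * J k) / 2)) atTop (𝓝 p))
    (hcorr : ∀ j (σ : ℝ), σ ^ 2 = 1 → Tendsto (fun k => Real.exp (-((m j + σ * m k) ^ 2 * J j +
      m k ^ 2 * (J k - J j)) / 2)) atTop (𝓝 (p * Real.exp (-(m j ^ 2 * J j) / 2)))) :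
    IsMixingSeq (sampledLaw P T α B t) (fun k z => Real.cos (f k * z k)) p := by
  have hae := hB.aemeasurable_sample α ht
  have hcos : ∀ k, Measurable fun z : ℕ → ℝ => Real.cos (f k * z k) := fun k => by fun_prop
  have e1 : ∀ k, ∫ z, Real.cos (f k * z k) ∂(sampledLaw P T α B t) =
      Real.exp (-(m k ^ 2 * J k) / 2) := by
    intro k
    rw [sampledLaw, integral_map hae (hcos k).aestronglyMeasurable]
    have h := hB.integral_cos_bridge α hT (ht k).1 le_rfl (ht k).2 0 (f k)
    simp only [zero_mul, zero_add, sub_self, mul_zero, add_zero] at h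
    rw [h, hm, hJ]
  have hXm := fun k => hB.aemeasurable_alphaWienerBridge α (ht k)
  have e2 : ∀ j k, j ≤ k → ∫ z, Real.cos (f k * z k) * Real.cos (f j * z j)
      ∂(sampledLaw P T α B t) =
      (Real.exp (-((m j + 1 * m k) ^ 2 * J j + m k ^ 2 * (J k - J j)) / 2) +
      Real.exp (-((m j + (-1) * m k) ^ 2 * J j + m k ^ 2 * (J k - J j)) / 2)) / 2 := by
    intro j k hjk
    have hmeas : Measurable fun z : ℕ → ℝ => Real.cos (f k * z k) * Real.cos (f j * z j) :=
      (hcos k).mul (hcos j)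
    rw [sampledLaw, integral_map hae hmeas.aestronglyMeasurable]
    have h1 := hB.integral_cos_bridge α hT (ht j).1 (hmono hjk) (ht k).2 (f j) (f k)
    have h2 := hB.integral_cos_bridge α hT (ht j).1 (hmono hjk) (ht k).2 (f j) (-f k)
    have hi : ∀ b : ℝ, Integrable (fun ω => Real.cos (f j * alphaWienerBridge T α B (t j) ω +
        b * alphaWienerBridge T α B (t k) ω)) P := fun b =>
      Integrable.of_bound (Real.measurable_cos.comp_aemeasurable
        (((hXm j).const_mul (f j)).add ((hXm k).const_mul b))).aestronglyMeasurable 1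
        (ae_of_all _ fun ω => Real.abs_cos_le_one _)
    have e : ∀ ω, Real.cos (f k * alphaWienerBridge T α B (t k) ω) *
        Real.cos (f j * alphaWienerBridge T α B (t j) ω) =
        (Real.cos (f j * alphaWienerBridge T α B (t j) ω + f k * alphaWienerBridge T α B (t k) ω) +
        Real.cos (f j * alphaWienerBridge T α B (t j) ω + -f k * alphaWienerBridge T α B (t k) ω))
        / 2 := fun ω => by
      rw [neg_mul, ← sub_eq_add_neg, Real.cos_add, Real.cos_sub]
      ring
    simp_rw [e]
    rw [integral_div, integral_add (hi _) (hi _), h1, h2, hm, hm, hJ, hJ]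
    congr 3
    · ring_nf
    · ring_nf
  refine ⟨by simpa only [e1] using hmean, fun j => ?_⟩
  rw [e1]
  have h := ((hcorr j 1 (by norm_num)).add (hcorr j (-1) (by norm_num))).div_const 2
  rw [add_self_div_two] at h
  refine h.congr' ?_
  filter_upwards [eventually_ge_atTop j] with k hk
  rw [e2 j k hk]

lemma bridgeClock_mono (α : ℝ) (hT : 0 < T) {s t : ℝ} (hst : s ≤ t) (ht : t < T) :
    bridgeClock T α s ≤ bridgeClock T α t := by
  rw [← sub_nonneg, bridgeClock_sub α hT (hst.trans_lt ht) ht]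
  exact intervalIntegral.integral_nonneg hst fun _ _ => sq_nonneg _

lemma bridgeClock_zero (α : ℝ) : bridgeClock T α 0 = 0 := intervalIntegral.integral_same

lemma bridgeClock_nonneg (α : ℝ) (hT : 0 < T) {t : ℝ} (ht : t ∈ Set.Ico 0 T) :
    0 ≤ bridgeClock T α t :=
  (bridgeClock_zero (T := T) α).symm.le.trans (bridgeClock_mono α hT ht.1 ht.2)

lemma bridgeKernel_sq (α : ℝ) {u : ℝ} (hu : u < T) :
    bridgeKernel T α u ^ 2 = (T - u) ^ (-(2 * α)) := by
  rw [bridgeKernel, ← Real.rpow_natCast, ← Real.rpow_mul (sub_pos.2 hu).le]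
  congr 1
  push_cast
  ring

lemma bridgeClock_eq_integral (α : ℝ) {t : ℝ} (ht : t ∈ Set.Ico 0 T) :
    bridgeClock T α t = ∫ v in (T - t)..T, v ^ (-(2 * α)) := by
  have h := intervalIntegral.integral_comp_sub_left (a := 0) (b := t)
    (fun v : ℝ => v ^ (-(2 * α))) T
  rw [sub_zero] at h
  rw [← h]
  refine intervalIntegral.integral_congr fun u hu => ?_
  rw [Set.uIcc_of_le ht.1] at hu
  exact bridgeKernel_sq α (hu.2.trans_lt ht.2)

lemma bridgeClock_eq_rpow {α : ℝ} (hα : 2 * α ≠ 1) {t : ℝ} (ht : t ∈ Set.Ico 0 T) :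
    bridgeClock T α t = (T ^ (1 - 2 * α) - (T - t) ^ (1 - 2 * α)) / (1 - 2 * α) := by
  have hd : 0 < T - t := sub_pos.2 ht.2
  have h0 : (0:ℝ) ∉ Set.uIcc (T - t) T := by
    rw [Set.uIcc_of_le (by linarith [ht.1])]
    exact fun h => absurd h.1 (not_le.2 hd)
  rw [bridgeClock_eq_integral α ht,
    integral_rpow (Or.inr ⟨fun h => hα (by linarith), h0⟩), neg_add_eq_sub]

lemma bridgeClock_half (hT : 0 < T) {t : ℝ} (ht : t ∈ Set.Ico 0 T) :
    bridgeClock T (1 / 2) t = Real.log (T / (T - t)) := by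
  have hd : 0 < T - t := sub_pos.2 ht.2
  rw [bridgeClock_eq_integral _ ht, ← integral_inv_of_pos hd hT]
  refine intervalIntegral.integral_congr fun v _ => ?_
  rw [show -(2 * (1 / 2 : ℝ)) = -1 by norm_num, Real.rpow_neg_one]

/-- The times `T - T e^{-k}` increasing to `T`. -/
def sampleTime (T : ℝ) (k : ℕ) : ℝ := T - T * Real.exp (-k)

lemma sub_sampleTime (T : ℝ) (k : ℕ) : T - sampleTime T k = T * Real.exp (-k) := by
  rw [sampleTime, sub_sub_cancel]

lemma sub_sampleTime_pos (hT : 0 < T) (k : ℕ) : 0 < T - sampleTime T k := by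
  rw [sub_sampleTime]; positivity

lemma sampleTime_mono (hT : 0 < T) : Monotone (sampleTime T) := by
  intro j k hjk
  have h : Real.exp (-(k:ℝ)) ≤ Real.exp (-(j:ℝ)) :=
    Real.exp_le_exp.2 (neg_le_neg (Nat.cast_le.2 hjk))
  exact sub_le_sub_left (mul_le_mul_of_nonneg_left h hT.le) T

lemma sampleTime_zero (T : ℝ) : sampleTime T 0 = 0 := by simp [sampleTime]

lemma sampleTime_mem (hT : 0 < T) (k : ℕ) : sampleTime T k ∈ Set.Ico 0 T :=
  ⟨(sampleTime_zero T).symm.le.trans (sampleTime_mono hT k.zero_le),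
    sub_pos.1 (sub_sampleTime_pos hT k)⟩

lemma tendsto_sub_sampleTime (hT : 0 < T) :
    Tendsto (fun k => T - sampleTime T k) atTop (𝓝[>] 0) := by
  refine tendsto_nhdsWithin_iff.2 ⟨?_, Eventually.of_forall (sub_sampleTime_pos hT)⟩
  simp_rw [sub_sampleTime]
  have h : Tendsto (fun k : ℕ => Real.exp (-(k:ℝ))) atTop (𝓝 0) :=
    Real.tendsto_exp_neg_atTop_nhds_zero.comp tendsto_natCast_atTop_atTop
  simpa using h.const_mul T

lemma tendsto_sub_sampleTime_rpow (hT : 0 < T) {r : ℝ} (hr : 0 < r) :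
    Tendsto (fun k => (T - sampleTime T k) ^ r) atTop (𝓝 0) := by
  have h := ((tendsto_sub_sampleTime hT).mono_right nhdsWithin_le_nhds).rpow_const
    (p := r) (Or.inr hr.le)
  rwa [Real.zero_rpow hr.ne'] at h

lemma tendsto_sub_sampleTime_rpow_atTop (hT : 0 < T) {r : ℝ} (hr : r < 0) :
    Tendsto (fun k => (T - sampleTime T k) ^ r) atTop atTop :=
  (tendsto_rpow_neg_nhdsGT_zero hr).comp (tendsto_sub_sampleTime hT)

lemma IsStandardWiener.isMixingSeq_of_tendsto_atTop {P : Measure Ω} [IsProbabilityMeasure P]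
    {B : ℝ → Ω → ℝ} (hB : IsStandardWiener P B) (α : ℝ) (hT : 0 < T) (f : ℕ → ℝ)
    (h : ∀ j, Tendsto (fun k => (f k * (T - sampleTime T k) ^ α) ^ 2 *
      (bridgeClock T α (sampleTime T k) - bridgeClock T α (sampleTime T j))) atTop atTop) :
    IsMixingSeq (sampledLaw P T α B (sampleTime T)) (fun k z => Real.cos (f k * z k)) 0 := by
  have hexp : ∀ j, Tendsto (fun k => Real.exp (-((f k * (T - sampleTime T k) ^ α) ^ 2 *
      (bridgeClock T α (sampleTime T k) - bridgeClock T α (sampleTime T j))) / 2)) atTop (𝓝 0) := by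
    intro j
    refine Real.tendsto_exp_atBot.comp ?_
    exact (tendsto_neg_atTop_atBot.comp (h j)).atBot_div_const two_pos
  refine hB.isMixingSeq_sampledLaw α hT (sampleTime_mem hT) (sampleTime_mono hT) f
    (fun _ => rfl) (fun _ => rfl) ?_ fun j σ _ => ?_
  · simpa only [sampleTime_zero, bridgeClock_zero, sub_zero] using hexp 0
  · rw [zero_mul]
    refine squeeze_zero (fun _ => (Real.exp_pos _).le) (fun k => ?_) (hexp j)
    have := mul_nonneg (sq_nonneg (f j * (T - sampleTime T j) ^ α +
      σ * (f k * (T - sampleTime T k) ^ α))) (bridgeClock_nonneg α hT (sampleTime_mem hT j))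
    refine Real.exp_le_exp.2 ?_
    linarith

lemma IsStandardWiener.isMixingSeq_of_tendsto {P : Measure Ω} [IsProbabilityMeasure P]
    {B : ℝ → Ω → ℝ} (hB : IsStandardWiener P B) (α : ℝ) (hT : 0 < T) (f : ℕ → ℝ) {r : ℝ}
    (h0 : Tendsto (fun k => f k * (T - sampleTime T k) ^ α) atTop (𝓝 0))
    (h : Tendsto (fun k => (f k * (T - sampleTime T k) ^ α) ^ 2 *
      bridgeClock T α (sampleTime T k)) atTop (𝓝 r)) :
    IsMixingSeq (sampledLaw P T α B (sampleTime T)) (fun k z => Real.cos (f k * z k))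
      (Real.exp (-r / 2)) := by
  refine hB.isMixingSeq_sampledLaw α hT (sampleTime_mem hT) (sampleTime_mono hT) f
    (fun _ => rfl) (fun _ => rfl) ?_ fun j σ _ => ?_
  · exact (Real.continuous_exp.tendsto _).comp (h.neg.div_const 2)
  · rw [← Real.exp_add]
    refine (Real.continuous_exp.tendsto _).comp ?_
    have h1 := (((h0.const_mul σ).const_add (f j * (T - sampleTime T j) ^ α)).pow 2).mul_const
      (bridgeClock T α (sampleTime T j))
    have h2 := h.sub ((h0.pow 2).mul_const (bridgeClock T α (sampleTime T j)))
    convert (h1.add h2).neg.div_const 2 using 2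
    · ring
    · ring

lemma IsStandardWiener.isProbabilityMeasure_sampledLaw {P : Measure Ω} [IsProbabilityMeasure P]
    {B : ℝ → Ω → ℝ} (hB : IsStandardWiener P B) (α : ℝ) {t : ℕ → ℝ}
    (ht : ∀ k, t k ∈ Set.Ico 0 T) : IsProbabilityMeasure (sampledLaw P T α B t) :=
  Measure.isProbabilityMeasure_map (hB.aemeasurable_sample α ht)

lemma IsStandardWiener.sampledLaw_mutuallySingular_of_isMixingSeq {P : Measure Ω}
    [IsProbabilityMeasure P] {B : ℝ → Ω → ℝ} (hB : IsStandardWiener P B) {α β : ℝ} (hT : 0 < T)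
    {f : ℕ → ℝ} {p q : ℝ} (hpq : p ≠ q)
    (hα : IsMixingSeq (sampledLaw P T α B (sampleTime T)) (fun k z => Real.cos (f k * z k)) p)
    (hβ : IsMixingSeq (sampledLaw P T β B (sampleTime T)) (fun k z => Real.cos (f k * z k)) q) :
    sampledLaw P T α B (sampleTime T) ⟂ₘ sampledLaw P T β B (sampleTime T) := by
  have := hB.isProbabilityMeasure_sampledLaw α (sampleTime_mem hT)
  have := hB.isProbabilityMeasure_sampledLaw β (sampleTime_mem hT)
  exact mutuallySingular_of_isMixingSeq hpq hα hβ (fun k => by fun_prop)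
    fun k x => Real.abs_cos_le_one _

lemma sub_sampleTime_rpow_mul (hT : 0 < T) (r s : ℝ) (k : ℕ) :
    (T - sampleTime T k) ^ (-r) * (T - sampleTime T k) ^ s = (T - sampleTime T k) ^ (s - r) := by
  rw [← Real.rpow_add (sub_sampleTime_pos hT k), neg_add_eq_sub]

lemma tendsto_sq_mul_bridgeClock_of_half_lt (hT : 0 < T) {γ : ℝ} (hγ : 1 / 2 < γ) :
    Tendsto (fun k => ((T - sampleTime T k) ^ (γ - 1 / 2)) ^ 2 * bridgeClock T γ (sampleTime T k))
      atTop (𝓝 (1 / (2 * γ - 1))) := by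
  have h0 := tendsto_sub_sampleTime_rpow hT (sub_pos.2 hγ)
  have h1 : Tendsto (fun k => 1 / (2 * γ - 1) - ((T - sampleTime T k) ^ (γ - 1 / 2)) ^ 2 *
      (T ^ (1 - 2 * γ) / (2 * γ - 1))) atTop (𝓝 (1 / (2 * γ - 1))) := by
    simpa using ((h0.pow 2).mul_const (T ^ (1 - 2 * γ) / (2 * γ - 1))).const_sub (1 / (2 * γ - 1))
  refine h1.congr fun k => ?_
  have hd := sub_sampleTime_pos hT k
  have hsq : ((T - sampleTime T k) ^ (γ - 1 / 2)) ^ 2 * (T - sampleTime T k) ^ (1 - 2 * γ) = 1 := by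
    rw [← Real.rpow_natCast, ← Real.rpow_mul hd.le, ← Real.rpow_add hd,
      show (γ - 1 / 2) * (2 : ℕ) + (1 - 2 * γ) = 0 by push_cast; ring, Real.rpow_zero]
  rw [bridgeClock_eq_rpow (by linarith) (sampleTime_mem hT k)]
  have hne : 2 * γ - 1 ≠ 0 := by linarith
  generalize (T - sampleTime T k) ^ (γ - 1 / 2) = x at *
  generalize (T - sampleTime T k) ^ (1 - 2 * γ) = y at *
  generalize T ^ (1 - 2 * γ) = z at *
  rw [← neg_sub (2 * γ) 1, div_neg]
  field_simp
  linear_combination -hsq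

/-- For `γ > 1/2` the bridge rescaled by `(T-t)^{-1/2}` converges in law to a centred Gaussian of
variance `1/(2γ-1)`. -/
lemma IsStandardWiener.isMixingSeq_of_half_lt {P : Measure Ω} [IsProbabilityMeasure P]
    {B : ℝ → Ω → ℝ} (hB : IsStandardWiener P B) (hT : 0 < T) {γ : ℝ} (hγ : 1 / 2 < γ) :
    IsMixingSeq (sampledLaw P T γ B (sampleTime T))
      (fun k z => Real.cos ((T - sampleTime T k) ^ (-(1 / 2) : ℝ) * z k))
      (Real.exp (-(1 / (2 * γ - 1)) / 2)) := by
  refine hB.isMixingSeq_of_tendsto γ hT _ ?_ ?_ <;> simp_rw [sub_sampleTime_rpow_mul hT]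
  · exact tendsto_sub_sampleTime_rpow hT (sub_pos.2 hγ)
  · exact tendsto_sq_mul_bridgeClock_of_half_lt hT hγ

lemma bridgeClock_half_sampleTime (hT : 0 < T) (k : ℕ) :
    bridgeClock T (1 / 2) (sampleTime T k) = k := by
  rw [bridgeClock_half hT (sampleTime_mem hT k), sub_sampleTime, div_mul_cancel_left₀ hT.ne',
    Real.exp_neg, inv_inv, Real.log_exp]

lemma IsStandardWiener.sampledLaw_mutuallySingular_of_half_lt {P : Measure Ω}
    [IsProbabilityMeasure P] {B : ℝ → Ω → ℝ} (hB : IsStandardWiener P B) (hT : 0 < T) {α β : ℝ}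
    (hα : 1 / 2 < α) (hαβ : α < β) :
    sampledLaw P T α B (sampleTime T) ⟂ₘ sampledLaw P T β B (sampleTime T) := by
  refine hB.sampledLaw_mutuallySingular_of_isMixingSeq hT (fun h => ?_)
    (hB.isMixingSeq_of_half_lt hT hα) (hB.isMixingSeq_of_half_lt hT (hα.trans hαβ))
  have h1 : 1 / (2 * β - 1) < 1 / (2 * α - 1) :=
    one_div_lt_one_div_of_lt (by linarith) (by linarith)
  have h2 := Real.exp_injective h
  linarith

lemma IsStandardWiener.sampledLaw_half_mutuallySingular {P : Measure Ω} [IsProbabilityMeasure P]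
    {B : ℝ → Ω → ℝ} (hB : IsStandardWiener P B) (hT : 0 < T) {β : ℝ} (hβ : 1 / 2 < β) :
    sampledLaw P T (1 / 2) B (sampleTime T) ⟂ₘ sampledLaw P T β B (sampleTime T) := by
  have hk : Tendsto (fun k : ℕ => (k : ℝ) ^ (-(1 / 4) : ℝ)) atTop (𝓝 0) :=
    (tendsto_rpow_neg_atTop (by norm_num)).comp tendsto_natCast_atTop_atTop
  have hk' : Tendsto (fun k : ℕ => (k : ℝ) ^ (1 / 2 : ℝ)) atTop atTop :=
    (tendsto_rpow_atTop (by norm_num)).comp tendsto_natCast_atTop_atTop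
  refine hB.sampledLaw_mutuallySingular_of_isMixingSeq hT
    (f := fun k => (k : ℝ) ^ (-(1 / 4) : ℝ) * (T - sampleTime T k) ^ (-(1 / 2) : ℝ))
    (Real.exp_ne_zero (-0 / 2)).symm (hB.isMixingSeq_of_tendsto_atTop _ hT _ fun j => ?_)
    (hB.isMixingSeq_of_tendsto β hT _ ?_ ?_) <;>
    simp_rw [mul_assoc, sub_sampleTime_rpow_mul hT]
  · refine tendsto_atTop_mono' _ ?_ (tendsto_atTop_add_const_right atTop (-(j : ℝ)) hk')
    filter_upwards [eventually_ge_atTop 1] with k hk1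
    have hkp : (0:ℝ) < k := by exact_mod_cast hk1
    have hk1' : (1:ℝ) ≤ k := by exact_mod_cast hk1
    rw [sub_self, Real.rpow_zero, mul_one,
      bridgeClock_half_sampleTime hT, bridgeClock_half_sampleTime hT, ← Real.rpow_natCast,
      ← Real.rpow_mul hkp.le, show (-(1 / 4) * (2 : ℕ) : ℝ) = -(1 / 2) by norm_num]
    have h1 : (k : ℝ) ^ (-(1 / 2) : ℝ) ≤ 1 :=
      Real.rpow_le_one_of_one_le_of_nonpos hk1' (by norm_num)
    have h2 : (k : ℝ) ^ (-(1 / 2) : ℝ) * k = (k : ℝ) ^ (1 / 2 : ℝ) := by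
      rw [← Real.rpow_add_one hkp.ne']
      norm_num
    nlinarith [(Nat.cast_nonneg j : (0:ℝ) ≤ j)]
  · simpa using hk.mul (tendsto_sub_sampleTime_rpow hT (sub_pos.2 hβ))
  · simpa [mul_pow, mul_assoc] using
      (hk.pow 2).mul (tendsto_sq_mul_bridgeClock_of_half_lt hT hβ)

lemma bridgeClock_le_rpow_mul {γ δ : ℝ} (hT : 0 < T) (hγδ : γ ≤ δ) {t : ℝ}
    (ht : t ∈ Set.Ico 0 T) :
    bridgeClock T δ t ≤ (T - t) ^ (-(2 * (δ - γ))) * bridgeClock T γ t := by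
  unfold bridgeClock
  rw [← intervalIntegral.integral_const_mul]
  refine intervalIntegral.integral_mono_on ht.1 (intervalIntegrable_bridgeKernel_sq δ hT ht.2)
    ((intervalIntegrable_bridgeKernel_sq γ hT ht.2).const_mul _) fun u hu => ?_
  have huT : u < T := hu.2.trans_lt ht.2
  have hup : 0 < T - u := sub_pos.2 huT
  rw [bridgeKernel_sq δ huT, bridgeKernel_sq γ huT,
    show -(2 * δ) = -(2 * (δ - γ)) + -(2 * γ) by ring, Real.rpow_add hup]
  refine mul_le_mul_of_nonneg_right ?_ (Real.rpow_nonneg hup.le _)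
  exact Real.rpow_le_rpow_of_nonpos (sub_pos.2 ht.2) (by linarith [hu.2]) (by linarith)

lemma bridgeClock_le_of_lt_half {γ : ℝ} (hγ : γ < 1 / 2) {t : ℝ} (ht : t ∈ Set.Ico 0 T) :
    bridgeClock T γ t ≤ T ^ (1 - 2 * γ) / (1 - 2 * γ) := by
  rw [bridgeClock_eq_rpow (by linarith) ht]
  exact div_le_div_of_nonneg_right
    (sub_le_self _ (Real.rpow_nonneg (sub_pos.2 ht.2).le _)) (by linarith)

lemma sampleTime_lt_succ (hT : 0 < T) (k : ℕ) : sampleTime T k < sampleTime T (k + 1) := by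
  have h : Real.exp (-((k + 1 : ℕ) : ℝ)) < Real.exp (-(k : ℝ)) := by
    rw [Real.exp_lt_exp]
    push_cast
    linarith
  exact sub_lt_sub_left (mul_lt_mul_of_pos_left h hT) T

lemma bridgeClock_lt (α : ℝ) (hT : 0 < T) {s t : ℝ} (hst : s < t) (ht : t < T) :
    bridgeClock T α s < bridgeClock T α t := by
  rw [← sub_pos, bridgeClock_sub α hT (hst.trans ht) ht]
  exact intervalIntegral.intervalIntegral_pos_of_pos_on
    (intervalIntegrable_bridgeKernel_sq α (hst.trans ht) ht)
    (fun u hu => pow_pos (Real.rpow_pos_of_pos (sub_pos.2 (hu.2.trans ht)) _) 2) hst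

lemma IsStandardWiener.sampledLaw_mutuallySingular_of_lt_half {P : Measure Ω}
    [IsProbabilityMeasure P] {B : ℝ → Ω → ℝ} (hB : IsStandardWiener P B) (hT : 0 < T) {α β : ℝ}
    (hα : α < 1 / 2) (hαβ : α < β) :
    sampledLaw P T α B (sampleTime T) ⟂ₘ sampledLaw P T β B (sampleTime T) := by
  obtain ⟨θ, hαθ, hθ⟩ := exists_between (lt_min hαβ hα)
  obtain ⟨η, hθη, hη⟩ := exists_between hθ
  obtain ⟨hηβ, hη2⟩ := lt_min_iff.1 hη
  refine hB.sampledLaw_mutuallySingular_of_isMixingSeq hT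
    (f := fun k => (T - sampleTime T k) ^ (-θ))
    (Real.exp_ne_zero (-0 / 2)).symm (hB.isMixingSeq_of_tendsto_atTop _ hT _ fun j => ?_)
    (hB.isMixingSeq_of_tendsto β hT _ ?_ ?_) <;>
    simp_rw [sub_sampleTime_rpow_mul hT]
  · have hpos : 0 < bridgeClock T α (sampleTime T (j + 1)) - bridgeClock T α (sampleTime T j) :=
      sub_pos.2 (bridgeClock_lt α hT (sampleTime_lt_succ hT j) (sampleTime_mem hT _).2)
    refine tendsto_atTop_mono' _ ?_ (((tendsto_pow_atTop two_ne_zero).comp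
      (tendsto_sub_sampleTime_rpow_atTop hT (sub_neg.2 hαθ))).atTop_mul_const hpos)
    filter_upwards [eventually_ge_atTop (j + 1)] with k hk
    exact mul_le_mul_of_nonneg_left (sub_le_sub_right
      (bridgeClock_mono α hT (sampleTime_mono hT hk) (sampleTime_mem hT k).2) _) (sq_nonneg _)
  · exact tendsto_sub_sampleTime_rpow hT (by linarith)
  · have h := (tendsto_sub_sampleTime_rpow hT (r := 2 * (η - θ)) (by linarith)).mul_const
      (T ^ (1 - 2 * η) / (1 - 2 * η))
    rw [zero_mul] at h
    refine squeeze_zero (fun k => mul_nonneg (sq_nonneg _)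
      (bridgeClock_nonneg β hT (sampleTime_mem hT k))) (fun k => ?_) h
    have hd := sub_sampleTime_pos hT k
    have hsq : ((T - sampleTime T k) ^ (β - θ)) ^ 2 * (T - sampleTime T k) ^ (-(2 * (β - η))) =
        (T - sampleTime T k) ^ (2 * (η - θ)) := by
      rw [← Real.rpow_natCast, ← Real.rpow_mul hd.le, ← Real.rpow_add hd]
      congr 1
      push_cast
      ring
    rw [← hsq, mul_assoc]
    refine mul_le_mul_of_nonneg_left ?_ (sq_nonneg _)
    exact (bridgeClock_le_rpow_mul hT hηβ.le (sampleTime_mem hT k)).trans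
      (mul_le_mul_of_nonneg_left (bridgeClock_le_of_lt_half hη2 (sampleTime_mem hT k))
        (Real.rpow_nonneg hd.le _))

lemma IsStandardWiener.sampledLaw_mutuallySingular_of_lt {P : Measure Ω}
    [IsProbabilityMeasure P] {B : ℝ → Ω → ℝ} (hB : IsStandardWiener P B) (hT : 0 < T) {α β : ℝ}
    (hαβ : α < β) :
    sampledLaw P T α B (sampleTime T) ⟂ₘ sampledLaw P T β B (sampleTime T) := by
  rcases lt_trichotomy α (1 / 2) with h | rfl | h
  · exact hB.sampledLaw_mutuallySingular_of_lt_half hT h hαβ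
  · exact hB.sampledLaw_half_mutuallySingular hT hαβ
  · exact hB.sampledLaw_mutuallySingular_of_half_lt hT h hαβ

/-- Sampled laws of Wiener bridges with different parameters are mutually singular. -/
lemma IsStandardWiener.sampledLaw_mutuallySingular {P : Measure Ω}
    [IsProbabilityMeasure P] {B : ℝ → Ω → ℝ} (hB : IsStandardWiener P B) (hT : 0 < T) {α β : ℝ}
    (hαβ : α ≠ β) :
    sampledLaw P T α B (sampleTime T) ⟂ₘ sampledLaw P T β B (sampleTime T) :=
  hαβ.lt_or_gt.elim (hB.sampledLaw_mutuallySingular_of_lt hT)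
    fun h => (hB.sampledLaw_mutuallySingular_of_lt hT h).symm

lemma measurable_sample_borelRho (hT : 0 < T) {t : ℕ → ℝ} (ht : ∀ k, t k ∈ Set.Ico 0 T) :
    Measurable[borelRho T] fun (y : ContPathIco T) k => y.1 (t k) := by
  let _ := borelRho T
  exact measurable_pi_lambda _ fun k => measurable_eval_borelRho hT (ht k)

lemma IsStandardWiener.measure_bridgePath_preimage_eq_one {P : Measure Ω} [IsProbabilityMeasure P]
    {B : ℝ → Ω → ℝ} (hB : IsStandardWiener P B) (α : ℝ) {t : ℕ → ℝ}
    (ht : ∀ k, t k ∈ Set.Ico 0 T) {S : Set (ℕ → ℝ)} (hS : sampledLaw P T α B t Sᶜ = 0) :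
    P (bridgePath T α B ⁻¹' {y | (fun k => y.1 (t k)) ∈ S}) = 1 := by
  have h : ∀ᵐ z ∂(sampledLaw P T α B t), z ∈ S := hS
  refine (measure_congr (eventuallyEq_univ.2 ?_)).trans measure_univ
  filter_upwards [ae_of_ae_map (hB.aemeasurable_sample α ht) h, hB.cont] with ω hω hc
  have hpath := continuousOn_alphaWienerBridge (T := T) α hc
  simpa [bridgePath, hpath] using hω

end Bridge

/-- For `α ≠ β` the laws of `(X^{(α)}_t)_{t∈[0,T)}` and
`(X^{(β)}_t)_{t∈[0,T)}` on `(C[0,T), ℬ(C[0,T)))` are mutually singular: there are disjoint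
Borel sets `S_α, S_β` carrying full mass under the respective laws. -/
theorem alphaWienerBridge_laws_singular
    (P : Measure Ω) [IsProbabilityMeasure P]
    (T : ℝ) (hT : 0 < T) (B : ℝ → Ω → ℝ) (hB : IsStandardWiener P B)
    (α β : ℝ) (hαβ : α ≠ β) :
    ∃ Sa Sb : Set (ContPathIco T),
      MeasurableSet[borelRho T] Sa ∧ MeasurableSet[borelRho T] Sb ∧ Sa ∩ Sb = ∅ ∧
      P (bridgePath T α B ⁻¹' Sa) = 1 ∧ P (bridgePath T β B ⁻¹' Sb) = 1 := by
  obtain ⟨S, hS, hSα, hSβ⟩ := hB.sampledLaw_mutuallySingular hT hαβ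
  have hmeas := measurable_sample_borelRho hT (sampleTime_mem hT)
  refine ⟨_, _, hmeas hS.compl, hmeas hS, ?_,
    hB.measure_bridgePath_preimage_eq_one α (sampleTime_mem hT) (by rwa [compl_compl]),
    hB.measure_bridgePath_preimage_eq_one β (sampleTime_mem hT) hSβ⟩
  rw [← Set.preimage_inter, Set.compl_inter_self, Set.preimage_empty]
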